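/- Let ι be a finite type with |ι| = N ≥ 2 and let (Y_C)_{C ∈ ι} be Boolean random variables on a probability space satisfying the product lower bound: for every z : ι → Bool, P(∀ C, Y_C = z_C) ≥ ∏_{C ∈ ι} P(Y_C = z_C). Suppose P(Y_C = true) = r for every C, with 1/N ≤ r ≤ 1. Then P(|{C : Y_C = true}| ≥ 2) ≥ 1 − (1 − 1/N)^N − (1 − 1/N)^(N−1). -/

import Mathlib

open MeasureTheory ProbabilityTheory

/-- The binomial probability of at most one success decreases in the success probability. -/
theorem one_sub_pow_mul_one_add_antitoneOn (k : ℕ) :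
    AntitoneOn (fun x : ℝ => (1 - x) ^ (k + 1) * (1 + (k + 1) * x)) (Set.Icc 0 1) := by
  have hd : ∀ x : ℝ, HasDerivAt (fun x : ℝ => (1 - x) ^ (k + 1) * (1 + (k + 1) * x))
      (-((k + 1) * (k + 2) * x * (1 - x) ^ k)) x := by
    intro x
    have h1 : HasDerivAt (fun x : ℝ => (1 - x) ^ (k + 1))
        (((k + 1 : ℕ) : ℝ) * (1 - x) ^ k * (-1)) x := by
      simpa using ((hasDerivAt_id x).const_sub 1).fun_pow (k + 1)
    have h2 : HasDerivAt (fun x : ℝ => 1 + ((k : ℝ) + 1) * x) ((k : ℝ) + 1) x := by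
      simpa using ((hasDerivAt_id x).const_mul ((k : ℝ) + 1)).const_add 1
    refine (h1.mul h2).congr_deriv ?_
    push_cast
    ring
  refine antitoneOn_of_deriv_nonpos (convex_Icc 0 1)
    (fun x _ => (hd x).continuousAt.continuousWithinAt)
    (fun x _ => (hd x).differentiableAt.differentiableWithinAt) fun x hx => ?_
  rw [interior_Icc] at hx
  rw [(hd x).deriv]
  have h0 : 0 ≤ x := hx.1.le
  have h1 : 0 ≤ 1 - x := by linarith [hx.2]
  have : 0 ≤ ((k : ℝ) + 1) * (k + 2) * x * (1 - x) ^ k := by positivity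
  linarith

/-- A union bound for the product Bernoulli weights of vectors with at most one `true` entry. -/
theorem sum_bernoulli_card_le_one_le {ι : Type*} [Fintype ι] [DecidableEq ι] (r : ℝ)
    (hr0 : 0 ≤ r) (hr1 : r ≤ 1) :
    ∑ z : ι → Bool with ¬ 2 ≤ (Finset.univ.filter fun C => z C = true).card,
      ∏ C, (if z C = true then r else 1 - r) ≤
    (1 - r) ^ Fintype.card ι + Fintype.card ι * (r * (1 - r) ^ (Fintype.card ι - 1)) := by
  have hnn : ∀ z : ι → Bool, 0 ≤ ∏ C, (if z C = true then r else 1 - r) := fun z =>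
    Finset.prod_nonneg fun C _ => by split_ifs <;> linarith
  let e : Option ι → ι → Bool := fun o C => decide (o = some C)
  have hsub : (Finset.univ.filter fun z : ι → Bool =>
      ¬ 2 ≤ (Finset.univ.filter fun C => z C = true).card) ⊆ Finset.univ.image e := by
    intro z hz
    simp only [Finset.mem_filter, Finset.mem_univ, true_and, not_le] at hz
    simp only [Finset.mem_image, Finset.mem_univ, true_and]
    have hle := Finset.card_le_one.mp (Nat.lt_succ_iff.mp hz)
    simp only [Finset.mem_filter, Finset.mem_univ, true_and] at hle
    by_cases h : ∃ C, z C = true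
    · obtain ⟨C, hC⟩ := h
      refine ⟨some C, funext fun D => ?_⟩
      by_cases hCD : C = D
      · subst hCD; simp [e, hC]
      · have : z D ≠ true := fun hD => hCD (hle C hC D hD)
        simp [e, hCD, this]
    · push Not at h
      exact ⟨none, funext fun D => by simp [e, h D]⟩
  have hinj : Function.Injective e := by
    intro o p h
    have h' : ∀ C, o = some C ↔ p = some C := fun C => by simpa [e] using congrFun h C
    exact Option.ext h'
  refine (Finset.sum_le_sum_of_subset_of_nonneg hsub fun z _ _ => hnn z).trans (le_of_eq ?_)
  rw [Finset.sum_image fun a _ b _ h => hinj h, Fintype.sum_option]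
  have hsome : ∀ D : ι, ∏ C, (if e (some D) C = true then r else 1 - r) =
      r * (1 - r) ^ (Fintype.card ι - 1) := by
    intro D
    rw [← Finset.mul_prod_erase _ _ (Finset.mem_univ D), Finset.prod_congr rfl
      (g := fun _ => 1 - r) fun C hC => by simp [e, (Finset.ne_of_mem_erase hC).symm]]
    simp [e, Finset.card_erase_of_mem]
  simp only [hsome]
  simp [e]

/-- More-than-one-leader lemma: with the product lower bound, common marginal
`r ≥ 1/N` and `N ≥ 2`, at least two of the indicators are `true` with
probability at least `1 − (1 − 1/N)^N − (1 − 1/N)^(N−1)`. -/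
theorem stmt_16 {Ω : Type*} [MeasureSpace Ω] [IsProbabilityMeasure (ℙ : Measure Ω)]
    {ι : Type*} [Fintype ι] (N : ℕ) (hN : 2 ≤ N) (hcard : Fintype.card ι = N)
    (Y : ι → Ω → Bool) (hYmeas : ∀ C, Measurable (Y C))
    (hprod : ∀ z : ι → Bool,
      ∏ C : ι, ℙ {ω | Y C ω = z C} ≤ ℙ {ω | ∀ C, Y C ω = z C})
    (r : ℝ) (hr1 : 1 / (N : ℝ) ≤ r) (hr2 : r ≤ 1)
    (hmarg : ∀ C, ℙ {ω | Y C ω = true} = ENNReal.ofReal r) :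
    1 - (1 - 1 / (N : ℝ)) ^ N - (1 - 1 / (N : ℝ)) ^ (N - 1) ≤
      (ℙ {ω | 2 ≤ (Finset.univ.filter fun C => Y C ω = true).card}).toReal := by
  classical
  have ha0 : (0 : ℝ) ≤ 1 / (N : ℝ) := by positivity
  have hr0 : 0 ≤ r := ha0.trans hr1
  have htrue : ∀ C, (ℙ : Measure Ω).real {ω | Y C ω = true} = r := fun C => by
    rw [measureReal_def, hmarg, ENNReal.toReal_ofReal hr0]
  have hfalse : ∀ C, (ℙ : Measure Ω).real {ω | Y C ω = false} = 1 - r := fun C => by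
    have hm : MeasurableSet {ω | Y C ω = true} := hYmeas C (measurableSet_singleton true)
    rw [← htrue C, ← probReal_compl_eq_one_sub hm]
    congr 1
    ext ω
    simp
  have hlow : ∀ z : ι → Bool, ∏ C, (if z C = true then r else 1 - r) ≤
      (ℙ : Measure Ω).real {ω | ∀ C, Y C ω = z C} := by
    intro z
    have h := ENNReal.toReal_mono (measure_ne_top _ _) (hprod z)
    rw [ENNReal.toReal_prod] at h
    refine le_of_eq_of_le (Finset.prod_congr rfl fun C _ => ?_) h
    cases hz : z C
    · simpa [measureReal_def] using (hfalse C).symm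
    · simpa [measureReal_def] using (htrue C).symm
  have hone : ∑ z : ι → Bool, ∏ C, (if z C = true then r else 1 - r) = 1 := by
    have h := Finset.prod_univ_sum (fun _ : ι => (Finset.univ : Finset Bool))
      fun _ b => if b = true then r else 1 - r
    rw [Fintype.piFinset_univ] at h
    rw [← h]
    simp
  have hevent : {ω | 2 ≤ (Finset.univ.filter fun C => Y C ω = true).card} =
      ⋃ z ∈ (Finset.univ.filter fun z : ι → Bool =>
        2 ≤ (Finset.univ.filter fun C => z C = true).card), {ω | ∀ C, Y C ω = z C} := by
    ext ω
    simp only [Set.mem_ofPred_eq, Set.mem_iUnion, Finset.mem_filter, Finset.mem_univ, true_and,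
      exists_prop]
    constructor
    · exact fun h => ⟨fun C => Y C ω, h, fun _ => rfl⟩
    · rintro ⟨z, hz, h⟩
      simpa only [h] using hz
  have hsum : (ℙ : Measure Ω).real {ω | 2 ≤ (Finset.univ.filter fun C => Y C ω = true).card} =
      ∑ z : ι → Bool with 2 ≤ (Finset.univ.filter fun C => z C = true).card,
        (ℙ : Measure Ω).real {ω | ∀ C, Y C ω = z C} := by
    rw [hevent]
    refine measureReal_biUnion_finset ?_ ?_
    · intro z _ w _ hzw
      refine Set.disjoint_left.mpr fun ω hω hω' => hzw (funext fun C => ?_)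
      exact (hω C).symm.trans (hω' C)
    · intro z _
      rw [Set.ofPred_forall]
      exact MeasurableSet.iInter fun C => hYmeas C (measurableSet_singleton (z C))
  rw [← measureReal_def, hsum]
  have hge := Finset.sum_le_sum fun z (_ : z ∈ Finset.univ.filter fun z : ι → Bool =>
    2 ≤ (Finset.univ.filter fun C => z C = true).card) => hlow z
  have hsplit := Finset.sum_filter_add_sum_filter_not Finset.univ
    (fun z : ι → Bool => 2 ≤ (Finset.univ.filter fun C => z C = true).card)
    fun z => ∏ C, (if z C = true then r else 1 - r)
  have hle := sum_bernoulli_card_le_one_le (ι := ι) r hr0 hr2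
  rw [hcard] at hle
  obtain ⟨k, rfl⟩ : ∃ k, N = k + 2 := ⟨N - 2, by omega⟩
  have hanti := one_sub_pow_mul_one_add_antitoneOn k ⟨ha0, hr1.trans hr2⟩ ⟨hr0, hr2⟩ hr1
  have hk : ((k + 2 : ℕ) : ℝ) * (1 / ((k + 2 : ℕ) : ℝ)) = 1 :=
    mul_one_div_cancel (by positivity)
  generalize 1 / ((k + 2 : ℕ) : ℝ) = a at *
  simp only [show k + 2 - 1 = k + 1 from rfl] at *
  push_cast at hk hle
  have e1 : (1 - r) ^ (k + 2) + ((k : ℝ) + 2) * (r * (1 - r) ^ (k + 1)) =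
      (1 - r) ^ (k + 1) * (1 + (k + 1) * r) := by ring
  have e2 : (1 - a) ^ (k + 2) + (1 - a) ^ (k + 1) = (1 - a) ^ (k + 1) * (1 + (k + 1) * a) := by
    linear_combination (-(1 - a) ^ (k + 1)) * hk
  linarith
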